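/- Let 0 ≤ t ≤ s < ∞. (1) For any P_t-null set 𝒩 ∈ 𝒩^t, it holds for P_t-a.s. ω ∈ Ω^t that 𝒩^{s,ω} ∈ 𝒩^s; consequently, for any two real-valued random variables ξ₁, ξ₂ on Ω^t with ξ₁ ≤ ξ₂ P_t-a.s., it holds for P_t-a.s. ω ∈ Ω^t that ξ₁^{s,ω} ≤ ξ₂^{s,ω} P_s-a.s. (2) For any stopping time τ ∈ 𝒯̄^t with τ ≥ s, it holds for P_t-a.s. ω ∈ Ω^t that τ^{s,ω} ∈ 𝒯̄^s. -/

import Mathlib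

open MeasureTheory ProbabilityTheory Set

noncomputable section

/-- Euclidean space ℝ^n. -/
abbrev Euc (n : ℕ) := EuclideanSpace ℝ (Fin n)

/-- The canonical path space `Ω^t`: continuous paths on `[t,∞)` starting from `0` at time `t`
(encoded as continuous functions on `ℝ` vanishing on `(-∞,t]`). -/
def CPath (d : ℕ) (t : ℝ) : Type :=
  {ω : ℝ → Euc d // Continuous ω ∧ ∀ r ≤ t, ω r = 0}

namespace CPath

/-- the coordinate (canonical) process `W^t`. -/
def W {d : ℕ} {t : ℝ} (r : ℝ) (ω : CPath d t) : Euc d := ω.1 r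

/-- the raw filtration `F^t_s = σ(W^t_r ; r ∈ [t,s])`. -/
def raw (d : ℕ) (t s : ℝ) : MeasurableSpace (CPath d t) :=
  ⨆ r ∈ Set.Icc t s, MeasurableSpace.comap (fun ω : CPath d t => ω.1 r) inferInstance

/-- the total raw σ-field `F^t = σ(W^t_r ; r ∈ [t,∞))`. -/
def rawInf (d : ℕ) (t : ℝ) : MeasurableSpace (CPath d t) :=
  ⨆ r ∈ Set.Ici t, MeasurableSpace.comap (fun ω : CPath d t => ω.1 r) inferInstance

/-- concatenation `ω ⊗_s ϖ` of paths at time `s`. -/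
def concat {d : ℕ} {t s : ℝ} (hts : t ≤ s) (ω : CPath d t) (ϖ : CPath d s) : CPath d t :=
  ⟨fun r => ω.1 (min r s) + ϖ.1 r,
    (ω.2.1.comp (continuous_id.min continuous_const)).add ϖ.2.1,
    fun r hr => by
      have h1 : ω.1 (min r s) = 0 := ω.2.2 _ (le_trans (min_le_left _ _) hr)
      have h2 : ϖ.1 r = 0 := ϖ.2.2 _ (hr.trans hts)
      simp [h1, h2]⟩

/-- the set `A^{s,ω} = {ϖ ∈ Ω^s : ω ⊗_s ϖ ∈ A}`. -/
def shSet {d : ℕ} {t s : ℝ} (hts : t ≤ s) (ω : CPath d t) (A : Set (CPath d t)) :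
    Set (CPath d s) := {ϖ | concat hts ω ϖ ∈ A}

/-- the shifted random variable / process `ξ^{s,ω}`. -/
def shRV {d : ℕ} {t s : ℝ} {γ : Type*} (hts : t ≤ s) (ω : CPath d t) (ξ : CPath d t → γ) :
    CPath d s → γ := fun ϖ => ξ (concat hts ω ϖ)

/-- `P` is the Wiener measure on `(Ω^t, F^t)`, i.e. the coordinate process is a standard
`d`-dimensional Brownian motion on `[t,∞)` under `P`. -/
def IsBrownian (d : ℕ) (t : ℝ) (P : @Measure (CPath d t) (rawInf d t)) : Prop :=
  @IsProbabilityMeasure _ (rawInf d t) P ∧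
  (∀ u v : ℝ, t ≤ u → u ≤ v →
    @ProbabilityTheory.Indep _
      (MeasurableSpace.comap (fun ω : CPath d t => ω.1 v - ω.1 u) inferInstance)
      (raw d t u) (rawInf d t) P) ∧
  (∀ u v : ℝ, t ≤ u → u ≤ v → ∀ i : Fin d,
    @Measure.map _ _ (rawInf d t) _ (fun ω : CPath d t => ω.1 v i - ω.1 u i) P
      = gaussianReal 0 (Real.toNNReal (v - u))) ∧
  (∀ u v : ℝ, t ≤ u → u ≤ v →
    @ProbabilityTheory.iIndepFun (CPath d t) (Fin d) (rawInf d t) (fun _ => ℝ)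
      (fun _ => (inferInstance : MeasurableSpace ℝ))
      (fun (i : Fin d) (ω : CPath d t) => ω.1 v i - ω.1 u i) P)

/-- the collection `𝒩^t` of `P_t`-null sets. -/
def nulls {d : ℕ} {t : ℝ} (P : @Measure (CPath d t) (rawInf d t)) : Set (Set (CPath d t)) :=
  {N | ∃ A, MeasurableSet[rawInf d t] A ∧ P A = 0 ∧ N ⊆ A}

/-- the augmented filtration `F̄^t_s = σ(F^t_s ∪ 𝒩^t)`. -/
def aug {d : ℕ} {t : ℝ} (P : @Measure (CPath d t) (rawInf d t)) (s : ℝ) :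
    MeasurableSpace (CPath d t) :=
  raw d t s ⊔ MeasurableSpace.generateFrom (nulls P)

/-- the augmented σ-field `F̄^t = σ(F^t ∪ 𝒩^t)`. -/
def augInf {d : ℕ} {t : ℝ} (P : @Measure (CPath d t) (rawInf d t)) :
    MeasurableSpace (CPath d t) :=
  rawInf d t ⊔ MeasurableSpace.generateFrom (nulls P)

/-- `τ ∈ 𝒯̄^t` : an `F̄^t`-stopping time with values in `[t,∞)`. -/
def IsStopTime {d : ℕ} {t : ℝ} (P : @Measure (CPath d t) (rawInf d t))
    (τ : CPath d t → ℝ) : Prop :=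
  (∀ ω, t ≤ τ ω) ∧ ∀ r, t ≤ r → MeasurableSet[aug P r] {ω | τ ω ≤ r}

end CPath

theorem MeasureTheory.measure_eq_of_sup {α : Type*} {m₀ m₁ m₂ : MeasurableSpace α}
    {μ ν : @Measure α m₀} [IsFiniteMeasure μ] (h₁ : m₁ ≤ m₀) (h₂ : m₂ ≤ m₀)
    (h : ∀ D E, MeasurableSet[m₁] D → MeasurableSet[m₂] E → μ (D ∩ E) = ν (D ∩ E))
    {S : Set α} (hS : MeasurableSet[m₁ ⊔ m₂] S) : μ S = ν S := by
  refine ext_on_measurableSpace_of_generate_finite m₀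
    {S | ∃ D E, MeasurableSet[m₁] D ∧ MeasurableSet[m₂] E ∧ S = D ∩ E}
    ?_ (sup_le h₁ h₂) ?_ ?_ ?_ hS
  · rintro _ ⟨D, E, hD, hE, rfl⟩
    exact h D E hD hE
  · refine le_antisymm (sup_le ?_ ?_) (MeasurableSpace.generateFrom_le ?_)
    · exact fun D hD => MeasurableSpace.measurableSet_generateFrom
        ⟨D, univ, hD, MeasurableSet.univ, by simp⟩
    · exact fun E hE => MeasurableSpace.measurableSet_generateFrom
        ⟨univ, E, MeasurableSet.univ, hE, by simp⟩
    · rintro _ ⟨D, E, hD, hE, rfl⟩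
      exact MeasurableSet.inter (le_sup_left (a := m₁) (b := m₂) D hD)
        (le_sup_right (a := m₁) (b := m₂) E hE)
  · rintro _ ⟨D, E, hD, hE, rfl⟩ _ ⟨D', E', hD', hE', rfl⟩ -
    exact ⟨D ∩ D', E ∩ E', hD.inter hD', hE.inter hE', Set.inter_inter_inter_comm _ _ _ _⟩
  · simpa using h univ univ MeasurableSet.univ MeasurableSet.univ

theorem MeasureTheory.measure_eq_of_iSup {α ι : Type*} [Nonempty ι] {m₀ : MeasurableSpace α}
    {m : ι → MeasurableSpace α} {μ ν : @Measure α m₀} [IsFiniteMeasure μ]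
    (hle : ∀ i, m i ≤ m₀) (hm : Directed (· ≤ ·) m)
    (h : ∀ i D, MeasurableSet[m i] D → μ D = ν D)
    {S : Set α} (hS : MeasurableSet[⨆ i, m i] S) : μ S = ν S := by
  refine ext_on_measurableSpace_of_generate_finite m₀ (⋃ i, {D | MeasurableSet[m i] D})
    ?_ (iSup_le hle) (MeasurableSpace.generateFrom_iUnion_measurableSet _).symm
    (isPiSystem_iUnion_of_directed_le _ (fun i => @MeasurableSpace.isPiSystem_measurableSet _ (m i))
      hm) ?_ hS
  · simp only [mem_iUnion]
    rintro D ⟨i, hD⟩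
    exact h i D hD
  · exact h (Classical.arbitrary ι) univ MeasurableSet.univ

namespace CPath

section

attribute [local instance] rawInf

variable {d : ℕ} {t r : ℝ}

theorem measurable_coord (v : ℝ) : Measurable fun ω : CPath d t => ω.1 v := by
  rcases le_total t v with h | h
  · rw [measurable_iff_comap_le]
    exact le_iSup₂_of_le (f := fun r (_ : r ∈ Set.Ici t) =>
      MeasurableSpace.comap (fun ω : CPath d t => ω.1 r) inferInstance) v h le_rfl
  · have : (fun ω : CPath d t => ω.1 v) = fun _ => 0 := funext fun ω => ω.2.2 v h
    rw [this]
    exact measurable_const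

theorem measurable_raw_coord {u v : ℝ} (hvu : v ≤ u) :
    Measurable[raw d t u] fun ω : CPath d t => ω.1 v := by
  rcases le_total t v with h | h
  · rw [measurable_iff_comap_le]
    exact le_iSup₂_of_le (f := fun r (_ : r ∈ Set.Icc t u) =>
      MeasurableSpace.comap (fun ω : CPath d t => ω.1 r) inferInstance) v ⟨h, hvu⟩ le_rfl
  · have : (fun ω : CPath d t => ω.1 v) = fun _ => 0 := funext fun ω => ω.2.2 v h
    rw [this]
    exact measurable_const

theorem measurable_rawInf_of_coord {α : Type*} {m : MeasurableSpace α} {f : α → CPath d t}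
    (h : ∀ v, t ≤ v → Measurable fun a => (f a).1 v) : Measurable f := by
  rw [measurable_iff_comap_le]
  simp only [rawInf, MeasurableSpace.comap_iSup, MeasurableSpace.comap_comp]
  exact iSup₂_le fun v hv => (h v hv).comap_le

theorem measurable_raw_of_coord {α : Type*} {m : MeasurableSpace α} {f : α → CPath d t} {u : ℝ}
    (h : ∀ v, t ≤ v → v ≤ u → Measurable fun a => (f a).1 v) : Measurable[m, raw d t u] f := by
  rw [measurable_iff_comap_le]
  simp only [raw, MeasurableSpace.comap_iSup, MeasurableSpace.comap_comp]
  exact iSup₂_le fun v hv => (h v hv.1 hv.2).comap_le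

theorem raw_le_rawInf (u : ℝ) : raw d t u ≤ rawInf d t :=
  fun _ hs => measurable_raw_of_coord (m := rawInf d t) (f := id)
    (fun v _ _ => measurable_coord v) hs

theorem raw_mono {u v : ℝ} (huv : u ≤ v) : raw d t u ≤ raw d t v :=
  fun _ hs => measurable_raw_of_coord (m := raw d t v) (f := id)
    (fun _ _ hw => measurable_raw_coord (hw.trans huv)) hs

/-- The increments after time `r`, as a path started at time `r`. -/
def shift (r : ℝ) (ω : CPath d t) : CPath d r :=
  ⟨fun v => ω.1 (max v r) - ω.1 r,
    (ω.2.1.comp (continuous_id.max continuous_const)).sub continuous_const,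
    fun _ hv => by simp [max_eq_right hv]⟩

/-- The path stopped at time `r`. -/
def stopped (r : ℝ) (ω : CPath d t) : CPath d t :=
  ⟨fun v => ω.1 (min v r), ω.2.1.comp (continuous_id.min continuous_const),
    fun _ hv => ω.2.2 _ ((min_le_left _ _).trans hv)⟩

theorem concat_shift (h : t ≤ r) (ω : CPath d t) : concat h ω (shift r ω) = ω := by
  refine Subtype.ext (funext fun v => ?_)
  simp only [concat, shift]
  rcases le_total v r with hv | hv <;> simp [hv]

theorem concat_stopped (h : t ≤ r) (ω : CPath d t) (ϖ : CPath d r) :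
    concat h (stopped r ω) ϖ = concat h ω ϖ := by
  refine Subtype.ext (funext fun v => ?_)
  simp [concat, stopped]

theorem stopped_concat (h : t ≤ r) (ω : CPath d t) (ϖ : CPath d r) :
    stopped r (concat h ω ϖ) = stopped r ω := by
  refine Subtype.ext (funext fun v => ?_)
  simp [concat, stopped, ϖ.2.2 (min v r) (min_le_right _ _)]

theorem shift_concat (h : t ≤ r) (ω : CPath d t) (ϖ : CPath d r) :
    shift r (concat h ω ϖ) = ϖ := by
  refine Subtype.ext (funext fun v => ?_)
  rcases le_total v r with hv | hv
  · simp [concat, shift, hv, ϖ.2.2 v hv, ϖ.2.2 r le_rfl]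
  · simp [concat, shift, hv, ϖ.2.2 r le_rfl]

theorem measurable_shift (r : ℝ) : Measurable (shift r : CPath d t → CPath d r) :=
  measurable_rawInf_of_coord fun _ _ => (measurable_coord _).sub (measurable_coord _)

theorem measurable_raw_shift {u : ℝ} (hu : r ≤ u) :
    Measurable[raw d t u, raw d r u] (shift r : CPath d t → CPath d r) :=
  measurable_raw_of_coord fun _ _ hv => Measurable.sub
    (measurable_raw_coord (max_le hv hu)) (measurable_raw_coord hu)

theorem measurable_stopped (r : ℝ) :
    Measurable[raw d t r, rawInf d t] (stopped r : CPath d t → CPath d t) :=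
  measurable_rawInf_of_coord fun _ _ => measurable_raw_coord (min_le_right _ _)

theorem measurable_concat (h : t ≤ r) :
    Measurable fun p : CPath d t × CPath d r => concat h p.1 p.2 :=
  measurable_rawInf_of_coord fun _ _ =>
    ((measurable_coord _).comp measurable_fst).add ((measurable_coord _).comp measurable_snd)

theorem measurable_raw_concat (h : t ≤ r) (u : ℝ) (ω : CPath d t) :
    Measurable[raw d r u, raw d t u] (concat h ω) :=
  measurable_raw_of_coord fun _ _ hv =>
    Measurable.add measurable_const (measurable_raw_coord hv)

theorem mem_stopped_iff {A : Set (CPath d t)} (hA : MeasurableSet[raw d t r] A) (ω : CPath d t) :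
    stopped r ω ∈ A ↔ ω ∈ A := by
  have key : ∀ A, MeasurableSet[raw d t r] A → stopped r ⁻¹' A = A := by
    have : raw d t r ≤ MeasurableSpace.invariants (m := ⊤) (stopped r : CPath d t → CPath d t) := by
      refine iSup₂_le fun v hv => ?_
      rintro _ ⟨B, -, rfl⟩
      refine ⟨trivial, ?_⟩
      ext ω
      have hω : (stopped r ω).1 v = ω.1 v := by simp [stopped, hv.2]
      change (stopped r ω).1 v ∈ B ↔ ω.1 v ∈ B
      rw [hω]
    exact fun A hA => (this A hA).2
  exact Set.ext_iff.mp (key A hA) ω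

/-- The law of a `d`-dimensional Brownian increment over a time span `a`. -/
def incrLaw (d : ℕ) (a : ℝ) : Measure (Euc d) :=
  (Measure.pi fun _ : Fin d => gaussianReal 0 a.toNNReal).map (WithLp.toLp 2)

/-- The coordinate process has independent increments with law `incrLaw`. -/
structure HasBrownianIncrements (P : Measure (CPath d t)) : Prop where
  prob : IsProbabilityMeasure P
  measure_inter : ∀ {u v : ℝ}, t ≤ u → u ≤ v → ∀ {A : Set (CPath d t)} {E : Set (Euc d)},
    MeasurableSet[raw d t u] A → MeasurableSet E →
    P (A ∩ {ω | ω.1 v - ω.1 u ∈ E}) = P A * incrLaw d (v - u) E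

theorem IsBrownian.hasBrownianIncrements {P : Measure (CPath d t)} (hP : IsBrownian d t P) :
    HasBrownianIncrements P := by
  obtain ⟨hprob, hind, hgauss, hiind⟩ := hP
  refine ⟨hprob, fun {u v} hu huv A E hA hE => ?_⟩
  have hm : Measurable fun ω : CPath d t => ω.1 v - ω.1 u :=
    (measurable_coord v).sub (measurable_coord u)
  have hmi : ∀ i, Measurable fun ω : CPath d t => ω.1 v i - ω.1 u i := fun i =>
    (measurable_pi_apply i).comp ((WithLp.measurable_ofLp 2 _).comp hm)
  have hlaw : P.map (fun ω : CPath d t => ω.1 v - ω.1 u) = incrLaw d (v - u) := by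
    have h := (iIndepFun_iff_map_fun_eq_pi_map fun i => (hmi i).aemeasurable).mp (hiind u v hu huv)
    simp only [hgauss u v hu huv] at h
    rw [incrLaw, ← h, Measure.map_map (WithLp.measurable_toLp 2 _) (measurable_pi_lambda _ hmi)]
    rfl
  have h := (Indep_iff _ _ P).mp (hind u v hu huv) _ A ⟨E, hE, rfl⟩ hA
  rw [inter_comm, mul_comm, ← hlaw, Measure.map_apply hm hE]
  exact h

theorem HasBrownianIncrements.map_shift {P : Measure (CPath d t)} (hP : HasBrownianIncrements P)
    (h : t ≤ r) : HasBrownianIncrements (P.map (shift r)) := by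
  have := hP.prob
  refine ⟨Measure.isProbabilityMeasure_map (measurable_shift r).aemeasurable,
    fun {u v} hu huv A E hA hE => ?_⟩
  have hE' : MeasurableSet {ω : CPath d r | ω.1 v - ω.1 u ∈ E} :=
    ((measurable_coord v).sub (measurable_coord u)) hE
  have hA' := raw_le_rawInf u A hA
  rw [Measure.map_apply (measurable_shift r) (hA'.inter hE'),
    Measure.map_apply (measurable_shift r) hA',
    ← hP.measure_inter (h.trans hu) huv (measurable_raw_shift hu hA) hE, preimage_inter]
  congr 2
  ext ω
  simp [shift, max_eq_left hu, max_eq_left (hu.trans huv)]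

/-- The σ-algebra generated by the coordinates at the times in `J`. -/
abbrev coordSigma (d : ℕ) (r : ℝ) (J : Finset ℝ) : MeasurableSpace (CPath d r) :=
  ⨆ v ∈ J, MeasurableSpace.comap (fun ω => ω.1 v) inferInstance

theorem measurable_coordSigma {J : Finset ℝ} {v : ℝ} (hv : v ∈ J) :
    Measurable[coordSigma d r J] fun ω : CPath d r => ω.1 v :=
  measurable_iff_comap_le.mpr (le_iSup₂_of_le (f := fun v (_ : v ∈ J) =>
      MeasurableSpace.comap (fun ω : CPath d r => ω.1 v) inferInstance) v hv le_rfl)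

theorem coordSigma_le_iff {J : Finset ℝ} {m : MeasurableSpace (CPath d r)} :
    coordSigma d r J ≤ m ↔ ∀ v ∈ J, Measurable[m] fun ω : CPath d r => ω.1 v :=
  iSup₂_le_iff.trans (forall₂_congr fun _ _ => measurable_iff_comap_le.symm)

theorem HasBrownianIncrements.measure_inter_shift_coordSigma {P : Measure (CPath d t)}
    {P' : Measure (CPath d r)} (hP : HasBrownianIncrements P) (hP' : HasBrownianIncrements P')
    (h : t ≤ r) {A : Set (CPath d t)} (hA : MeasurableSet[raw d t r] A) (J : Finset ℝ) :
    ∀ {D : Set (CPath d r)}, MeasurableSet[coordSigma d r J] D →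
      P (A ∩ shift r ⁻¹' D) = P A * P' D := by
  have := hP.prob
  have := hP'.prob
  induction J using Finset.induction_on_max with
  | empty =>
    intro D hD
    have hbot : coordSigma d r ∅ ≤ ⊥ := coordSigma_le_iff.mpr (by simp)
    rcases MeasurableSpace.measurableSet_bot_iff.mp (hbot D hD) with rfl | rfl <;> simp
  | insert a J hJ ih =>
    intro D hD
    have hA' := raw_le_rawInf r A hA
    obtain har | hra := le_or_gt a r
    · refine ih ?_
      refine coordSigma_le_iff.mpr (fun v hv => ?_) D hD
      have hvr : v ≤ r := by
        rcases Finset.mem_insert.mp hv with rfl | hv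
        · exact har
        · exact (hJ v hv).le.trans har
      have : (fun ω : CPath d r => ω.1 v) = fun _ => 0 := funext fun ω => ω.2.2 v hvr
      rw [this]
      exact measurable_const
    obtain ⟨u, hru, hua, hJu, hu⟩ : ∃ u, r ≤ u ∧ u ≤ a ∧ (∀ v ∈ J, v ≤ u) ∧
        Measurable[coordSigma d r J] fun ω : CPath d r => ω.1 u := by
      have h0 : ∀ u ≤ r, Measurable[coordSigma d r J] fun ω : CPath d r => ω.1 u := fun u hu => by
        have : (fun ω : CPath d r => ω.1 u) = fun _ => 0 := funext fun ω => ω.2.2 u hu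
        rw [this]
        exact measurable_const
      rcases J.eq_empty_or_nonempty with rfl | hne
      · exact ⟨r, le_rfl, hra.le, by simp, h0 r le_rfl⟩
      rcases le_total r (J.max' hne) with hr | hr
      · exact ⟨J.max' hne, hr, (hJ _ (J.max'_mem hne)).le, fun v hv => J.le_max' v hv,
          measurable_coordSigma (J.max'_mem hne)⟩
      · exact ⟨r, le_rfl, hra.le, fun v hv => (J.le_max' v hv).trans hr, h0 r le_rfl⟩
    have hincr : Measurable fun ω : CPath d r => ω.1 a - ω.1 u :=
      (measurable_coord a).sub (measurable_coord u)
    have hJle : coordSigma d r J ≤ raw d r u :=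
      coordSigma_le_iff.mpr fun v hv => measurable_raw_coord (hJu v hv)
    have hle : coordSigma d r (insert a J) ≤ coordSigma d r J ⊔
        MeasurableSpace.comap (fun ω : CPath d r => ω.1 a - ω.1 u) inferInstance := by
      refine coordSigma_le_iff.mpr fun v hv => ?_
      rcases Finset.mem_insert.mp hv with rfl | hv
      · have : (fun ω : CPath d r => ω.1 v) = fun ω => (ω.1 v - ω.1 u) + ω.1 u := by simp
        rw [this]
        exact Measurable.add ((comap_measurable _).mono le_sup_right le_rfl)
          (hu.mono le_sup_left le_rfl)
      · exact (measurable_coordSigma hv).mono le_sup_left le_rfl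
    have hmap : ∀ {D : Set (CPath d r)}, MeasurableSet D →
        (P.restrict A).map (shift r) D = P (A ∩ shift r ⁻¹' D) := fun {D} hD => by
      rw [Measure.map_apply (measurable_shift r) hD,
        Measure.restrict_apply (measurable_shift r hD), inter_comm]
    have hDm : MeasurableSet D :=
      coordSigma_le_iff.mpr (fun v _ => measurable_coord v) D hD
    have key : (P.restrict A).map (shift r) D = (P A • P') D := by
      refine measure_eq_of_sup (hJle.trans (raw_le_rawInf u)) hincr.comap_le ?_ (hle D hD)
      rintro D _ hD ⟨E, hE, rfl⟩
      have hDr := raw_le_rawInf u D (hJle D hD)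
      rw [hmap (hDr.inter (hincr hE)), Measure.smul_apply, smul_eq_mul]
      have h1 := hP'.measure_inter hru hua (hJle D hD) hE
      have h2 := hP.measure_inter (h.trans hru) hua
        ((raw_mono hru A hA).inter (measurable_raw_shift hru (hJle D hD))) hE
      rw [ih hD] at h2
      have h3 : A ∩ shift r ⁻¹' (D ∩ (fun ω : CPath d r => ω.1 a - ω.1 u) ⁻¹' E) =
          A ∩ shift r ⁻¹' D ∩ {ω | ω.1 a - ω.1 u ∈ E} := by
        ext ω
        have hω : (shift r ω).1 a - (shift r ω).1 u = ω.1 a - ω.1 u := by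
          simp [shift, max_eq_left hru, max_eq_left hra.le]
        change (ω ∈ A ∧ shift r ω ∈ D ∧ (shift r ω).1 a - (shift r ω).1 u ∈ E) ↔
          (ω ∈ A ∧ shift r ω ∈ D) ∧ ω.1 a - ω.1 u ∈ E
        rw [hω, and_assoc]
      rw [h3, h2, mul_assoc, ← h1]
      rfl
    rw [← hmap hDm, key, Measure.smul_apply, smul_eq_mul]

theorem HasBrownianIncrements.measure_inter_shift {P : Measure (CPath d t)}
    {P' : Measure (CPath d r)} (hP : HasBrownianIncrements P) (hP' : HasBrownianIncrements P')
    (h : t ≤ r) {A : Set (CPath d t)} (hA : MeasurableSet[raw d t r] A)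
    {D : Set (CPath d r)} (hD : MeasurableSet D) :
    P (A ∩ shift r ⁻¹' D) = P A * P' D := by
  have := hP.prob
  have hmap : ∀ {D : Set (CPath d r)}, MeasurableSet D →
      (P.restrict A).map (shift r) D = P (A ∩ shift r ⁻¹' D) := fun {D} hD => by
    rw [Measure.map_apply (measurable_shift r) hD,
      Measure.restrict_apply (measurable_shift r hD), inter_comm]
  have hle : ∀ J, coordSigma d r J ≤ rawInf d r := fun J =>
    coordSigma_le_iff.mpr fun v _ => measurable_coord v
  have hgen : rawInf d r ≤ ⨆ J, coordSigma d r J := by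
    refine iSup₂_le fun v _ => le_iSup_of_le {v} ?_
    exact measurable_iff_comap_le.mp (measurable_coordSigma (Finset.mem_singleton_self v))
  have hdir : Directed (· ≤ ·) (coordSigma d r) :=
    Monotone.directed_le fun J K hJK => coordSigma_le_iff.mpr fun v hv =>
      measurable_coordSigma (Finset.mem_of_subset hJK hv)
  rw [← hmap hD, measure_eq_of_iSup (ν := P A • P') hle hdir (fun J D hD => ?_) (hgen D hD),
    Measure.smul_apply, smul_eq_mul]
  rw [hmap (hle J D hD), hP.measure_inter_shift_coordSigma hP' h hA J hD, Measure.smul_apply,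
    smul_eq_mul]

theorem HasBrownianIncrements.map_concat {P : Measure (CPath d t)}
    {P' : Measure (CPath d r)} (hP : HasBrownianIncrements P) (hP' : HasBrownianIncrements P')
    (h : t ≤ r) : (P.prod P').map (fun p => concat h p.1 p.2) = P := by
  have := hP.prob
  have := hP'.prob
  have hstopped : Measurable (stopped r : CPath d t → CPath d t) :=
    (measurable_stopped r).mono (raw_le_rawInf r) le_rfl
  have hprod : (P.map (stopped r)).prod P' = P.map fun ω => (stopped r ω, shift r ω) := by
    have := Measure.isProbabilityMeasure_map (μ := P) hstopped.aemeasurable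
    refine Measure.prod_eq fun A D hA hD => ?_
    rw [Measure.map_apply (hstopped.prodMk (measurable_shift r)) (hA.prod hD),
      Measure.map_apply hstopped hA,
      ← hP.measure_inter_shift hP' h (measurable_stopped r hA) hD]
    rfl
  have hmp : (P.map (stopped r)).prod P' = (P.prod P').map (Prod.map (stopped r) id) := by
    rw [← Measure.map_prod_map _ _ hstopped measurable_id, Measure.map_id]
  have h1 : ((P.map (stopped r)).prod P').map (fun p => concat h p.1 p.2) = P := by
    rw [hprod, Measure.map_map (measurable_concat h) (hstopped.prodMk (measurable_shift r))]
    convert Measure.map_id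
    ext1 ω
    simp [concat_stopped, concat_shift]
  rw [hmp, Measure.map_map (measurable_concat h) (hstopped.prodMap measurable_id)] at h1
  convert h1 using 2
  ext1 p
  simp [concat_stopped]

theorem mem_nulls_iff {P : Measure (CPath d t)} {N : Set (CPath d t)} :
    N ∈ nulls P ↔ P N = 0 :=
  ⟨fun ⟨_, _, hA, hNA⟩ => measure_mono_null hNA hA, fun hN =>
    ⟨toMeasurable P N, measurableSet_toMeasurable P N, by rwa [measure_toMeasurable],
      subset_toMeasurable P N⟩⟩

theorem measurableSet_aug_iff {P : Measure (CPath d t)} {u : ℝ} {A : Set (CPath d t)} :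
    MeasurableSet[aug P u] A ↔ ∃ B, MeasurableSet[raw d t u] B ∧ A =ᵐ[P] B := by
  constructor
  · intro hA
    have hle : aug P u ≤ eventuallyMeasurableSpace (raw d t u) (ae P) := by
      refine sup_le le_eventuallyMeasurableSpace (MeasurableSpace.generateFrom_le ?_)
      rintro N ⟨M, -, hM, hNM⟩
      exact ⟨∅, @MeasurableSet.empty _ (raw d t u), ae_eq_empty.mpr (measure_mono_null hNM hM)⟩
    exact hle A hA
  · rintro ⟨B, hB, hAB⟩
    have hN : ∀ N, P N = 0 → MeasurableSet[aug P u] N := fun N hN =>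
      le_sup_right (a := raw d t u) N
        (MeasurableSpace.measurableSet_generateFrom (mem_nulls_iff.mpr hN))
    have h1 := hN _ (ae_le_set.mp hAB.le)
    have h2 := hN _ (ae_le_set.mp hAB.symm.le)
    have hB' : MeasurableSet[aug P u] B :=
      le_sup_left (b := MeasurableSpace.generateFrom (nulls P)) B hB
    have : A = (B \ (B \ A)) ∪ (A \ B) := by
      ext ω
      by_cases h : ω ∈ A <;> by_cases h' : ω ∈ B <;> simp [h, h']
    rw [this]
    exact MeasurableSet.union (MeasurableSet.diff hB' h2) h1

theorem aug_mono (P : Measure (CPath d t)) {u v : ℝ} (huv : u ≤ v) : aug P u ≤ aug P v :=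
  sup_le_sup_right (raw_mono huv) _

theorem measurable_comap_shift {u v : ℝ} (hru : r ≤ u) (hrv : r ≤ v) :
    Measurable[MeasurableSpace.comap (shift r) (rawInf d r)]
      fun ω : CPath d t => ω.1 v - ω.1 u := by
  have h : ∀ w, Measurable[MeasurableSpace.comap (shift r) (rawInf d r)]
      fun ω : CPath d t => ω.1 (max w r) - ω.1 r :=
    fun w => (measurable_coord (t := r) w).comp (comap_measurable _)
  have h2 : Measurable[MeasurableSpace.comap (shift r) (rawInf d r)]
      fun ω : CPath d t => (ω.1 (max v r) - ω.1 r) - (ω.1 (max u r) - ω.1 r) := (h v).sub (h u)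
  simpa [max_eq_left hru, max_eq_left hrv] using h2

theorem comap_shift_anti {q q' : ℝ} (h : q ≤ q') :
    MeasurableSpace.comap (shift q') (rawInf d q') ≤
      MeasurableSpace.comap (shift q : CPath d t → CPath d q) (rawInf d q) :=
  measurable_iff_comap_le.mp <| measurable_rawInf_of_coord fun _ _ =>
    measurable_comap_shift h (h.trans (le_max_right _ _))

/-- Events in the germ field after time `r` are independent of the increments after `r`. -/
theorem HasBrownianIncrements.measure_inter_shift_of_germ {P : Measure (CPath d t)}
    (hP : HasBrownianIncrements P) (h : t ≤ r) {A : Set (CPath d t)}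
    (hA : ∀ q, r < q → MeasurableSet[aug P q] A)
    {D : Set (CPath d r)} (hD : MeasurableSet D) :
    P (A ∩ shift r ⁻¹' D) = P A * P (shift r ⁻¹' D) := by
  have := hP.prob
  set q : ℕ → ℝ := fun n => r + 1 / ((n : ℝ) + 1) with hq
  have hrq : ∀ n, r < q n := fun n => by
    have : (0 : ℝ) < 1 / ((n : ℝ) + 1) := by positivity
    simp only [hq]
    linarith
  have hqanti : Antitone q := fun m n hmn => by
    simp only [hq]
    have : (m : ℝ) ≤ n := by exact_mod_cast hmn
    gcongr
  have hqlim : Filter.Tendsto q Filter.atTop (nhds r) := by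
    simpa [hq] using tendsto_one_div_add_atTop_nhds_zero_nat.const_add r
  set m : ℕ → MeasurableSpace (CPath d t) :=
    fun n => MeasurableSpace.comap (shift (q n)) (rawInf d (q n)) with hm
  have hle : ∀ n, m n ≤ rawInf d t := fun n => (measurable_shift (q n)).comap_le
  have hmono : Monotone m := fun a b hab => comap_shift_anti (hqanti hab)
  have hDm : MeasurableSet[⨆ n, m n] (shift r ⁻¹' D : Set (CPath d t)) := by
    suffices Measurable[⨆ n, m n] (shift r : CPath d t → CPath d r) from this hD
    refine measurable_rawInf_of_coord fun v _ => ?_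
    refine @measurable_of_tendsto_metrizable _ _ (⨆ n, m n) _ _ _ _
      (f := fun n (ω : CPath d t) => ω.1 (max v (q n)) - ω.1 (q n))
      (g := fun ω => ω.1 (max v r) - ω.1 r) (fun n => ?_) ?_
    · exact (measurable_comap_shift le_rfl (le_max_right _ _)).mono (le_iSup m n) le_rfl
    · refine tendsto_pi_nhds.mpr fun ω => ?_
      exact ((ω.2.1.tendsto _).comp (tendsto_const_nhds.max hqlim)).sub
        ((ω.2.1.tendsto r).comp hqlim)
  have hS : MeasurableSet (shift r ⁻¹' D : Set (CPath d t)) := measurable_shift r hD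
  have key : (P.restrict A) (shift r ⁻¹' D) = (P A • P) (shift r ⁻¹' D) := by
    refine measure_eq_of_iSup hle hmono.directed_le (fun n E hE => ?_) hDm
    have hEm := hle n E hE
    obtain ⟨E', hE', rfl⟩ := hE
    obtain ⟨B, hB, hAB⟩ := measurableSet_aug_iff.mp (hA (q n) (hrq n))
    have htq := h.trans (hrq n).le
    rw [Measure.restrict_congr_set hAB, measure_congr hAB, Measure.restrict_apply hEm, inter_comm,
      hP.measure_inter_shift (hP.map_shift htq) htq hB hE', Measure.smul_apply, smul_eq_mul,
      Measure.map_apply (measurable_shift _) hE']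
  rwa [Measure.restrict_apply hS, inter_comm, Measure.smul_apply, smul_eq_mul] at key

/-- Right-continuity of the augmented filtration. -/
theorem HasBrownianIncrements.measurableSet_aug_of_germ {P : Measure (CPath d t)}
    (hP : HasBrownianIncrements P) (h : t ≤ r) {A : Set (CPath d t)}
    (hA : ∀ q, r < q → MeasurableSet[aug P q] A) : MeasurableSet[aug P r] A := by
  have := hP.prob
  obtain ⟨B, hB, hAB⟩ := measurableSet_aug_iff.mp (hA (r + 1) (by linarith))
  replace hB : MeasurableSet B := raw_le_rawInf _ B hB
  replace hA : ∀ q, r < q → MeasurableSet[aug P q] B := fun q hq => by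
    obtain ⟨C, hC, hAC⟩ := measurableSet_aug_iff.mp (hA q hq)
    exact measurableSet_aug_iff.mpr ⟨C, hC, hAB.symm.trans hAC⟩
  set P' := P.map (shift r : CPath d t → CPath d r) with hP'def
  have hP' : HasBrownianIncrements P' := hP.map_shift h
  have := hP'.prob
  have hcm := measurable_concat (d := d) h
  have hBc : MeasurableSet ((fun p : CPath d t × CPath d r => concat h p.1 p.2) ⁻¹' B) := hcm hB
  set g : CPath d t → ENNReal := fun ω => P' (concat h ω ⁻¹' B) with hg
  have hgm : Measurable g := measurable_measure_prodMk_left hBc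
  have hgstopped : ∀ ω, g (stopped r ω) = g ω := fun ω => by
    simp only [hg]
    congr 1
    ext ϖ
    simp [concat_stopped]
  have hgr : Measurable[raw d t r] g := by
    have : g = g ∘ stopped r := funext fun ω => (hgstopped ω).symm
    rw [this]
    exact hgm.comp (measurable_stopped r)
  have hgc : ∀ ω ϖ, g (concat h ω ϖ) = g ω := fun ω ϖ => by
    rw [← hgstopped, stopped_concat, hgstopped]
  have hlint : ∀ f : CPath d t → ENNReal, Measurable f →
      ∫⁻ ω, f ω ∂P = ∫⁻ ω, ∫⁻ ϖ, f (concat h ω ϖ) ∂P' ∂P := fun f hf => by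
    conv_lhs => rw [← hP.map_concat hP' h]
    rw [lintegral_map hf hcm]
    exact lintegral_prod _ (hf.comp hcm).aemeasurable
  have hmemc : ∀ {E}, MeasurableSet[raw d t r] E → ∀ ω ϖ, concat h ω ϖ ∈ E ↔ ω ∈ E :=
    fun {E} hE ω ϖ => by rw [← mem_stopped_iff hE, stopped_concat, mem_stopped_iff hE]
  have hEB : ∀ {E}, MeasurableSet[raw d t r] E → P (B ∩ E) = ∫⁻ ω in E, g ω ∂P := fun {E} hE => by
    have hEm := raw_le_rawInf r E hE
    rw [← lintegral_indicator_one (hB.inter hEm),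
      hlint _ (measurable_one.indicator (hB.inter hEm)), ← lintegral_indicator hEm]
    refine lintegral_congr fun ω => ?_
    by_cases hω : ω ∈ E
    · rw [indicator_of_mem hω]
      refine Eq.trans ?_ (lintegral_indicator_one (hcm.comp measurable_prodMk_left hB))
      refine lintegral_congr fun ϖ => ?_
      by_cases hb : concat h ω ϖ ∈ B <;> simp [indicator, hb, hmemc hE, hω]
    · simp [indicator, hmemc hE, hω]
  have hdens : P.withDensity g = P.withDensity (B.indicator 1) := by
    have hgle : ∫⁻ ω, g ω ∂P ≠ ⊤ := by
      rw [← setLIntegral_univ, ← hEB MeasurableSet.univ]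
      exact measure_ne_top P _
    have : IsFiniteMeasure (P.withDensity g) := isFiniteMeasure_withDensity hgle
    refine Measure.ext fun S hS => ?_
    have hgen : rawInf d t ≤ raw d t r ⊔
        MeasurableSpace.comap (shift r : CPath d t → CPath d r) (rawInf d r) := by
      refine iSup₂_le fun v _ => measurable_iff_comap_le.mp ?_
      rcases le_total v r with hv | hv
      · exact (measurable_raw_coord hv).mono le_sup_left le_rfl
      · have : (fun ω : CPath d t => ω.1 v) = fun ω => (ω.1 v - ω.1 r) + ω.1 r := by simp
        rw [this]
        exact ((measurable_comap_shift le_rfl hv).mono le_sup_right le_rfl).add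
          ((measurable_raw_coord le_rfl).mono le_sup_left le_rfl)
    refine measure_eq_of_sup (raw_le_rawInf r) (measurable_shift r).comap_le ?_ (hgen S hS)
    rintro E _ hE ⟨D, hD, rfl⟩
    have hEm := raw_le_rawInf r E hE
    have hDm := measurable_shift (t := t) r hD
    have hL : P.withDensity g (E ∩ shift r ⁻¹' D) = P (B ∩ E) * P' D := by
      rw [withDensity_apply _ (hEm.inter hDm), ← lintegral_indicator (hEm.inter hDm),
        hlint _ (hgm.indicator (hEm.inter hDm)), hEB hE, ← lintegral_indicator hEm,
        ← lintegral_mul_const _ (hgm.indicator hEm)]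
      refine lintegral_congr fun ω => ?_
      rw [← lintegral_indicator_one hD, ← lintegral_const_mul _ (measurable_one.indicator hD)]
      refine lintegral_congr fun ϖ => ?_
      by_cases hω : ω ∈ E <;> by_cases hϖ : ϖ ∈ D <;>
        simp [indicator, hmemc hE, hω, hϖ, shift_concat, hgc]
    rw [hL, withDensity_indicator_one hB, Measure.restrict_apply (hEm.inter hDm), inter_comm _ B,
      ← inter_assoc, hP.measure_inter_shift_of_germ h (A := B ∩ E) (fun q hq =>
        MeasurableSet.inter (hA q hq) ((aug_mono P hq.le) _
          (le_sup_left (b := MeasurableSpace.generateFrom (nulls P)) E hE))) hD,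
      hP'def, Measure.map_apply (measurable_shift r) hD]
  have hae : g =ᵐ[P] B.indicator 1 :=
    (withDensity_eq_iff_of_sigmaFinite hgm.aemeasurable
      (measurable_one.indicator hB).aemeasurable).mp hdens
  refine measurableSet_aug_iff.mpr ⟨g ⁻¹' {1}, hgr (measurableSet_singleton 1), hAB.trans ?_⟩
  filter_upwards [hae] with ω hω
  refine propext ?_
  change ω ∈ B ↔ g ω = 1
  rw [hω]
  by_cases hb : ω ∈ B <;> simp [hb]

theorem HasBrownianIncrements.ae_ae_concat {P : Measure (CPath d t)}
    {P' : Measure (CPath d r)} (hP : HasBrownianIncrements P) (hP' : HasBrownianIncrements P')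
    (h : t ≤ r) {p : CPath d t → Prop} (hp : ∀ᵐ ω ∂P, p ω) :
    ∀ᵐ ω ∂P, ∀ᵐ ϖ ∂P', p (concat h ω ϖ) := by
  have := hP.prob
  have := hP'.prob
  rw [← hP.map_concat hP' h] at hp
  exact Measure.ae_ae_of_ae_prod (ae_of_ae_map (measurable_concat h).aemeasurable hp)

theorem HasBrownianIncrements.ae_isStopTime_shRV {P : Measure (CPath d t)}
    {P' : Measure (CPath d r)} (hP : HasBrownianIncrements P) (hP' : HasBrownianIncrements P')
    (h : t ≤ r) {τ : CPath d t → ℝ} (hτ : IsStopTime P τ) (hrτ : ∀ ω, r ≤ τ ω) :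
    ∀ᵐ ω ∂P, IsStopTime P' (shRV h ω τ) := by
  have hq : ∀ᵐ ω ∂P, ∀ q : ℚ, r ≤ q → MeasurableSet[aug P' q] {ϖ | shRV h ω τ ϖ ≤ q} := by
    refine ae_all_iff.mpr fun q => ?_
    by_cases hrq : r ≤ q
    swap
    · exact Filter.Eventually.of_forall fun ω hq => absurd hq hrq
    obtain ⟨B, hB, hτB⟩ := measurableSet_aug_iff.mp (hτ.2 q (h.trans hrq))
    filter_upwards [hP.ae_ae_concat hP' h hτB.mem_iff] with ω hω _
    refine measurableSet_aug_iff.mpr ⟨concat h ω ⁻¹' B, measurable_raw_concat h q ω hB, ?_⟩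
    filter_upwards [hω] with ϖ hϖ
    exact propext hϖ
  filter_upwards [hq] with ω hω
  refine ⟨fun ϖ => hrτ _, fun u hu => hP'.measurableSet_aug_of_germ hu fun v huv => ?_⟩
  have heq : {ϖ | shRV h ω τ ϖ ≤ u} =
      ⋂ q : {q : ℚ // u < q ∧ (q : ℝ) < v}, {ϖ | shRV h ω τ ϖ ≤ (q : ℚ)} := by
    ext ϖ
    simp only [mem_ofPred_eq, mem_iInter]
    refine ⟨fun hϖ q => hϖ.trans q.2.1.le, fun hϖ => ?_⟩
    by_contra! hlt
    obtain ⟨q, h1, h2⟩ := exists_rat_btwn (lt_min hlt huv)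
    exact absurd (hϖ ⟨q, h1, h2.trans_le (min_le_right _ _)⟩)
      (not_le.mpr (h2.trans_le (min_le_left _ _)))
  rw [heq]
  exact MeasurableSet.iInter fun q => aug_mono P' q.2.2.le _ (hω q (hu.trans q.2.1.le))

end

end CPath
open CPath in
/-- Proposition 3.3: (1) the shift of a `P_t`-null set is `P_s`-null for a.e. `ω`, and a.s.
inequalities between random variables are preserved by shifting; (2) the shift of a stopping
time `τ ∈ 𝒯̄^t` with `τ ≥ s` is, for a.e. `ω`, a stopping time of `𝒯̄^s`. -/
theorem stmt8 {d : ℕ} {t s : ℝ} (h0t : 0 ≤ t) (hts : t ≤ s)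
    (Pt : @Measure (CPath d t) (rawInf d t)) (hPt : IsBrownian d t Pt)
    (Ps : @Measure (CPath d s) (rawInf d s)) (hPs : IsBrownian d s Ps) :
    -- (1) null sets
    (∀ N : Set (CPath d t), N ∈ nulls Pt → ∀ᵐ ω ∂Pt, shSet hts ω N ∈ nulls Ps) ∧
    -- (1) a.s. inequalities
    (∀ ξ₁ ξ₂ : CPath d t → ℝ, (∀ᵐ ω ∂Pt, ξ₁ ω ≤ ξ₂ ω) →
      ∀ᵐ ω ∂Pt, ∀ᵐ ϖ ∂Ps, shRV hts ω ξ₁ ϖ ≤ shRV hts ω ξ₂ ϖ) ∧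
    -- (2) stopping times
    (∀ τ : CPath d t → ℝ, IsStopTime Pt τ → (∀ ω, s ≤ τ ω) →
      ∀ᵐ ω ∂Pt, IsStopTime Ps (shRV hts ω τ)) := by
  have hBt := hPt.hasBrownianIncrements
  have hBs := hPs.hasBrownianIncrements
  refine ⟨fun N hN => ?_, fun ξ₁ ξ₂ hξ => hBt.ae_ae_concat hBs hts hξ,
    fun τ hτ hsτ => hBt.ae_isStopTime_shRV hBs hts hτ hsτ⟩
  have hN' : ∀ᵐ ω ∂Pt, ω ∉ N := measure_eq_zero_iff_ae_notMem.mp (mem_nulls_iff.mp hN)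
  filter_upwards [hBt.ae_ae_concat hBs hts hN'] with ω hω
  exact mem_nulls_iff.mpr (measure_eq_zero_iff_ae_notMem.mpr hω)
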